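/- In the first order setting, let x ∈ D₂ be the exact solution of A₂x = f, A₁*x = g, πx = k, let x̃ ∈ H₂ be arbitrary, and set e := x − x̃ and e_{A₂*} := π_{R(A₂*)}e. Then ‖e_{A₂*}‖_{H₂} = min over ξ ∈ D(A₂) of ( c₂‖A₂ξ − f‖_{H₃} + ‖ξ − x̃‖_{H₂} ), and the minimum is attained at ξ̂ := e_{A₂*} + x̃, which belongs to D(A₂) and satisfies A₂ξ̂ = f. -/

import Mathlib

open Submodule LinearPMap RealInnerProductSpace

noncomputable section

/-- The range of a partially defined linear operator, as a submodule. -/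
def pRan {E F : Type*} [AddCommGroup E] [Module ℝ E] [AddCommGroup F] [Module ℝ F]
    (A : E →ₗ.[ℝ] F) : Submodule ℝ F :=
  LinearMap.range A.toFun

/-- The kernel of a partially defined linear operator, as a submodule of the ambient space. -/
def pKer {E F : Type*} [AddCommGroup E] [Module ℝ E] [AddCommGroup F] [Module ℝ F]
    (A : E →ₗ.[ℝ] F) : Submodule ℝ E :=
  (LinearMap.ker A.toFun).map A.domain.subtype

variable {H₁ H₂ H₃ : Type*}
  [NormedAddCommGroup H₁] [InnerProductSpace ℝ H₁] [CompleteSpace H₁]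
  [NormedAddCommGroup H₂] [InnerProductSpace ℝ H₂] [CompleteSpace H₂]
  [NormedAddCommGroup H₃] [InnerProductSpace ℝ H₃] [CompleteSpace H₃]

theorem mem_pKer_iff {E F : Type*} [AddCommGroup E] [Module ℝ E] [AddCommGroup F] [Module ℝ F]
    {A : E →ₗ.[ℝ] F} {x : E} : x ∈ pKer A ↔ ∃ hx : x ∈ A.domain, A ⟨x, hx⟩ = 0 := by
  constructor
  · rintro ⟨y, hy, rfl⟩
    exact ⟨y.2, hy⟩
  · rintro ⟨hx, h⟩
    exact ⟨⟨x, hx⟩, h, rfl⟩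

/-- The kernel of a closed densely defined operator is the orthogonal complement of the range of
its adjoint. -/
theorem orthogonal_pRan_adjoint {E F : Type*}
    [NormedAddCommGroup E] [InnerProductSpace ℝ E] [CompleteSpace E]
    [NormedAddCommGroup F] [InnerProductSpace ℝ F] [CompleteSpace F]
    {A : E →ₗ.[ℝ] F} (hdense : Dense (A.domain : Set E)) (hclosed : A.IsClosed) :
    (pRan (A†))ᗮ = pKer A := by
  ext n
  rw [mem_pKer_iff]
  constructor
  · intro hn
    let K : Submodule ℝ (WithLp 2 (E × F)) :=
      A.graph.comap (WithLp.linearEquiv 2 ℝ (E × F)).toLinearMap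
    have hK : IsClosed (K : Set (WithLp 2 (E × F))) :=
      IsClosed.preimage (WithLp.prod_continuous_ofLp 2 E F) hclosed
    have hmem : WithLp.toLp 2 (n, (0 : F)) ∈ K := by
      have : CompleteSpace K := hK.completeSpace_coe
      rw [← K.orthogonal_orthogonal, mem_orthogonal]
      intro u hu
      have horth : ∀ a : A.domain, ⟪-u.fst, (a : E)⟫ = ⟪u.snd, A a⟫ := by
        intro a
        have ha : WithLp.toLp 2 ((a : E), A a) ∈ K := A.mem_graph a
        have h := K.inner_left_of_mem_orthogonal ha hu
        rw [WithLp.prod_inner_apply] at h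
        simp only [inner_neg_left]
        exact neg_eq_of_add_eq_zero_right h
      have hdom : u.snd ∈ (A†).domain := mem_adjoint_domain_of_exists _ ⟨_, horth⟩
      have hran : -u.fst ∈ pRan (A†) := ⟨⟨u.snd, hdom⟩, adjoint_apply_eq hdense _ horth⟩
      have h := (pRan (A†)).inner_right_of_mem_orthogonal hran hn
      rw [inner_neg_left, neg_eq_zero] at h
      rw [WithLp.prod_inner_apply]
      simpa using h
    obtain ⟨y, hy, hy0⟩ := A.mem_graph_iff.1 (show (n, (0 : F)) ∈ A.graph from hmem)
    change (y : E) = n at hy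
    subst hy
    exact ⟨y.2, hy0⟩
  · rintro ⟨hn, h0⟩
    rw [mem_orthogonal]
    rintro _ ⟨w, rfl⟩
    have h := adjoint_isFormalAdjoint hdense w ⟨n, hn⟩
    rw [h0, inner_zero_right] at h
    exact h

/-- If `e` is orthogonal to the kernel of a closed densely defined operator `A`, then its pairing
with `y ∈ D(A)` is controlled by `‖A y‖`, with the Friedrichs/Poincaré constant of `A`. -/
theorem inner_le_of_mem_orthogonal_pKer {E F : Type*}
    [NormedAddCommGroup E] [InnerProductSpace ℝ E] [CompleteSpace E]
    [NormedAddCommGroup F] [InnerProductSpace ℝ F] [CompleteSpace F]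
    {A : E →ₗ.[ℝ] F} (hdense : Dense (A.domain : Set E)) (hclosed : A.IsClosed) {c : ℝ}
    (hc : ∀ v : A.domain, (v : E) ∈ (pKer A)ᗮ → ‖(v : E)‖ ≤ c * ‖A v‖)
    {e : E} (he : e ∈ (pKer A)ᗮ) (y : A.domain) :
    ⟪e, (y : E)⟫ ≤ ‖e‖ * (c * ‖A y‖) := by
  have hK : IsClosed (pKer A : Set E) := by
    rw [← orthogonal_pRan_adjoint hdense hclosed]
    exact isClosed_orthogonal _
  have : CompleteSpace (pKer A) := hK.completeSpace_coe
  obtain ⟨n, hn, v, hv, hy⟩ := (pKer A).exists_add_mem_mem_orthogonal (y : E)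
  obtain ⟨hnd, hn0⟩ := mem_pKer_iff.1 hn
  have hvy : v = y - n := by rw [hy, add_sub_cancel_left]
  have hvd : v ∈ A.domain := hvy ▸ A.domain.sub_mem y.2 hnd
  have hAv : A ⟨v, hvd⟩ = A y := by
    have : (⟨v, hvd⟩ : A.domain) = y - ⟨n, hnd⟩ := Subtype.ext hvy
    rw [this, A.map_sub, hn0, sub_zero]
  calc ⟪e, (y : E)⟫ = ⟪e, v⟫ := by
        rw [hy, inner_add_right, (pKer A).inner_left_of_mem_orthogonal hn he, zero_add]
    _ ≤ ‖e‖ * ‖v‖ := real_inner_le_norm e v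
    _ ≤ ‖e‖ * (c * ‖A y‖) := by
        rw [← hAv]
        exact mul_le_mul_of_nonneg_left (hc ⟨v, hvd⟩ hv) (norm_nonneg e)

/-- Functional a posteriori error estimate, upper bound for the `R(A₂†)` part
of the error: with `e = x - xt` and `e_{A₂†} = π_{R(A₂†)} e`,
`‖e_{A₂†}‖ = min_{ξ ∈ D(A₂)} ( c₂‖A₂ξ - f‖ + ‖ξ - xt‖ )`, the minimum being attained at
`ξ̂ = e_{A₂†} + xt ∈ D(A₂)`, which satisfies `A₂ ξ̂ = f`. -/
theorem statement12 (A₁ : H₁ →ₗ.[ℝ] H₂) (A₂ : H₂ →ₗ.[ℝ] H₃)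
    (hdense₁ : Dense (A₁.domain : Set H₁)) (hdense₂ : Dense (A₂.domain : Set H₂))
    (hclosed₁ : A₁.IsClosed) (hclosed₂ : A₂.IsClosed)
    (hcomplex : pRan A₁ ≤ pKer A₂)
    (hrange₁ : IsClosed (pRan A₁ : Set H₂)) (hrange₂ : IsClosed (pRan A₂ : Set H₃))
    (f : H₃) (g : H₁) (k : H₂)
    (hf : f ∈ pRan A₂) (hg : g ∈ pRan (A₁†)) (hk : k ∈ pKer A₂ ⊓ pKer (A₁†))
    -- `x ∈ D₂` is the exact solution: `A₂ x = f`, `A₁† x = g`, `π x = k`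
    (x : H₂) (hx₂ : x ∈ A₂.domain) (hx₁ : x ∈ (A₁†).domain)
    (hxf : A₂ ⟨x, hx₂⟩ = f) (hxg : A₁† ⟨x, hx₁⟩ = g)
    (hxk : x - k ∈ (pKer A₂ ⊓ pKer (A₁†))ᗮ)
    -- `xt` is an arbitrary (possibly nonconforming) approximation
    (xt : H₂)
    -- `c₂` is the Friedrichs/Poincaré constant for `A₂` (and for `A₂†`)
    (c₂ : ℝ) (hc₂pos : 0 < c₂)
    (hc₂ : ∀ v : A₂.domain, (v : H₂) ∈ (pKer A₂)ᗮ → ‖(v : H₂)‖ ≤ c₂ * ‖A₂ v‖)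
    (hc₂adj : ∀ w : (A₂†).domain, (w : H₃) ∈ (pKer (A₂†))ᗮ → ‖(w : H₃)‖ ≤ c₂ * ‖A₂† w‖)
    -- `eA₂s = π_{R(A₂†)} (x - xt)`
    (eA₂s : H₂) (heA₂s : eA₂s ∈ pRan (A₂†))
    (heA₂sperp : (x - xt) - eA₂s ∈ (pRan (A₂†))ᗮ) :
    IsLeast {r : ℝ | ∃ ξ : A₂.domain, r = c₂ * ‖A₂ ξ - f‖ + ‖(ξ : H₂) - xt‖} ‖eA₂s‖
    ∧ ∃ hξ : eA₂s + xt ∈ A₂.domain,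
        A₂ ⟨eA₂s + xt, hξ⟩ = f
        ∧ c₂ * ‖A₂ ⟨eA₂s + xt, hξ⟩ - f‖ + ‖(eA₂s + xt) - xt‖ = ‖eA₂s‖ := by
  have hker := orthogonal_pRan_adjoint hdense₂ hclosed₂
  obtain ⟨hpd, hp0⟩ := mem_pKer_iff.1 (hker ▸ heA₂sperp)
  have hξeq : eA₂s + xt = x - (x - xt - eA₂s) := by abel
  have hξ : eA₂s + xt ∈ A₂.domain := hξeq ▸ A₂.domain.sub_mem hx₂ hpd
  have hξf : A₂ ⟨eA₂s + xt, hξ⟩ = f := by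
    have : (⟨eA₂s + xt, hξ⟩ : A₂.domain) = ⟨x, hx₂⟩ - ⟨_, hpd⟩ := Subtype.ext hξeq
    rw [this, A₂.map_sub, hp0, sub_zero, hxf]
  have hval : c₂ * ‖A₂ ⟨eA₂s + xt, hξ⟩ - f‖ + ‖(eA₂s + xt) - xt‖ = ‖eA₂s‖ := by
    simp [hξf]
  refine ⟨⟨⟨⟨_, hξ⟩, hval.symm⟩, ?_⟩, hξ, hξf, hval⟩
  rintro _ ⟨ξ, rfl⟩
  have heorth : eA₂s ∈ (pKer A₂)ᗮ := hker ▸ le_orthogonal_orthogonal _ heA₂s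
  have hsplit : ‖eA₂s‖ * ‖eA₂s‖ = ⟪eA₂s, x - ξ⟫ + ⟪eA₂s, ξ - xt⟫ := by
    have h := (pRan (A₂†)).inner_right_of_mem_orthogonal heA₂s heA₂sperp
    rw [inner_sub_right, sub_eq_zero] at h
    rw [← real_inner_self_eq_norm_mul_norm, ← h, ← inner_add_right, sub_add_sub_cancel]
  have hfst : ⟪eA₂s, x - ξ⟫ ≤ ‖eA₂s‖ * (c₂ * ‖A₂ ξ - f‖) := by
    have h := inner_le_of_mem_orthogonal_pKer hdense₂ hclosed₂ hc₂ heorth (⟨x, hx₂⟩ - ξ)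
    rwa [A₂.map_sub, hxf, norm_sub_rev] at h
  have hsnd : ⟪eA₂s, ξ - xt⟫ ≤ ‖eA₂s‖ * ‖(ξ : H₂) - xt‖ := real_inner_le_norm _ _
  rcases (norm_nonneg eA₂s).eq_or_lt with h0 | hpos
  · rw [← h0]
    positivity
  · refine le_of_mul_le_mul_left ?_ hpos
    rw [mul_add, hsplit]
    exact add_le_add hfst hsnd
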